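/- arXiv:2304.10925 — 6 statements merged into one kernel-verified Lean document; each statement's English description precedes it below -/
import Mathlib

section
/- For all a_1, a_2, …, a_n ∈ L_n, the left-normed products satisfy a_1a_2a_3⋯a_n = a_2a_1a_3⋯a_n; that is, the polynomial x_1x_2x_3⋯x_n − x_2x_1x_3⋯x_n is a polynomial identity of L_n. -/
/-- The multiplication of the `n`-dimensional null-filiform Leibniz algebra `L_n`,
realized on coordinate vectors `Fin n → K`: the bilinear map determined by
`e_i · e_1 = e_{i+1}` for `1 ≤ i ≤ n-1` and all other products of basis vectors zero. -/
def nfMul (K : Type*) [Field K] (n : ℕ) (x y : Fin n → K) : Fin n → K :=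
  fun k => if (k : ℕ) = 0 then 0
    else y ⟨0, Nat.lt_of_le_of_lt (Nat.zero_le _) k.isLt⟩ *
         x ⟨(k : ℕ) - 1, Nat.lt_of_le_of_lt (Nat.sub_le _ _) k.isLt⟩

/-- The left-normed product `a₁a₂⋯a_k = (⋯((a₁a₂)a₃)⋯)a_k` of a list of elements
of `L_n` (junk value `0` for the empty list). -/
def lnProd (K : Type*) [Field K] (n : ℕ) : List (Fin n → K) → (Fin n → K)
  | [] => 0
  | a :: t => t.foldl (nfMul K n) a

theorem foldl_nfMul_congr (K : Type*) [Field K] (n : ℕ) (l : List (Fin n → K)) :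
    ∀ (x y : Fin n → K), (∀ k : Fin n, (k : ℕ) + l.length < n → x k = y k) →
      l.foldl (nfMul K n) x = l.foldl (nfMul K n) y := by
  induction l with
  | nil =>
    intro x y h
    funext k
    exact h k (by simp)
  | cons b t ih =>
    intro x y h
    simp only [List.foldl_cons]
    apply ih
    intro k hk
    unfold nfMul
    by_cases h0 : (k : ℕ) = 0
    · simp [h0]
    · simp only [h0, if_false]
      rw [h]
      simp only [List.length_cons]
      omega

/-- For all `a₁, …, a_n ∈ L_n` the left-normed products satisfy
`a₁a₂a₃⋯a_n = a₂a₁a₃⋯a_n`; that is, `x₁x₂x₃⋯x_n − x₂x₁x₃⋯x_n` is a polynomial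
identity of `L_n`.  (The first two factors `a₁, a₂` and the remaining `n − 2`
factors `a₃, …, a_n` are given separately.) -/
theorem Ln_identity_swap_first_two (K : Type*) [Field K] (n : ℕ) (hn : 1 ≤ n) :
    ∀ (a₁ a₂ : Fin n → K) (a : Fin (n - 2) → (Fin n → K)),
      lnProd K n (a₁ :: a₂ :: List.ofFn a) = lnProd K n (a₂ :: a₁ :: List.ofFn a) := by
  intro a₁ a₂ a
  simp only [lnProd, List.foldl_cons]
  apply foldl_nfMul_congr
  intro k hk
  rw [List.length_ofFn] at hk
  unfold nfMul
  by_cases h0 : (k : ℕ) = 0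
  · simp [h0]
  · have h1 : (k : ℕ) = 1 := by omega
    simp only [h1, one_ne_zero, if_false, Nat.sub_self]
    exact mul_comm _ _
end

section
/- For every permutation σ of {1, …, n} and all a_1, …, a_n ∈ L_n, the left-normed products satisfy a_{σ(1)}a_{σ(2)}⋯a_{σ(n)} = a_1a_2⋯a_n; that is, x_{σ(1)}x_{σ(2)}⋯x_{σ(n)} − x_1x_2⋯x_n is a polynomial identity of L_n. -/
theorem nfMul_foldl (K : Type*) [Field K] (n : ℕ) (h0 : 0 < n) (t : List (Fin n → K)) :
    ∀ (x : Fin n → K) (k : Fin n), t.foldl (nfMul K n) x k =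
      if (k : ℕ) < t.length then 0
      else (t.map (fun y => y ⟨0, h0⟩)).prod *
        x ⟨(k : ℕ) - t.length, Nat.lt_of_le_of_lt (Nat.sub_le _ _) k.isLt⟩ := by
  induction t with
  | nil => intro x k; simp
  | cons a t ih =>
    intro x k
    rw [List.foldl_cons, ih]
    simp only [nfMul, List.length_cons, List.map_cons, List.prod_cons]
    by_cases h1 : (k : ℕ) < t.length
    · rw [if_pos h1, if_pos (by omega)]
    · rw [if_neg h1]
      by_cases h2 : (k : ℕ) < t.length + 1
      · rw [if_pos h2, if_pos (by omega), mul_zero]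
      · rw [if_neg h2, if_neg (by omega)]
        simp only [Nat.sub_sub]
        ring

theorem lnProd_apply (K : Type*) [Field K] (n : ℕ) (h0 : 0 < n) (l : List (Fin n → K))
    (hl : l.length = n) (k : Fin n) : lnProd K n l k =
      if (k : ℕ) + 1 < n then 0 else (l.map (fun y => y ⟨0, h0⟩)).prod := by
  cases l with
  | nil => simp at hl; omega
  | cons a t =>
    simp only [List.length_cons] at hl
    have hk := k.isLt
    simp only [lnProd, nfMul_foldl K n h0, List.map_cons, List.prod_cons]
    by_cases h : (k : ℕ) + 1 < n
    · rw [if_pos h, if_pos (by omega)]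
    · rw [if_neg h, if_neg (by omega), mul_comm]
      congr 3
      omega

/-- For every permutation `σ` of `{1, …, n}` and all `a₁, …, a_n ∈ L_n` the left-normed
products satisfy `a_{σ(1)}a_{σ(2)}⋯a_{σ(n)} = a₁a₂⋯a_n`; that is,
`x_{σ(1)}x_{σ(2)}⋯x_{σ(n)} − x₁x₂⋯x_n` is a polynomial identity of `L_n`. -/
theorem Ln_identity_full_permutation (K : Type*) [Field K] (n : ℕ) (hn : 1 ≤ n) :
    ∀ σ : Equiv.Perm (Fin n), ∀ a : Fin n → (Fin n → K),
      lnProd K n (List.ofFn fun i => a (σ i)) = lnProd K n (List.ofFn a) := by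
  intro σ a
  funext k
  rw [lnProd_apply K n hn _ (by simp), lnProd_apply K n hn _ (by simp)]
  have hp : (List.ofFn fun i => a (σ i)).Perm (List.ofFn a) := Equiv.Perm.ofFn_comp_perm σ a
  rw [(hp.map _).prod_eq]
end

section
/- If γ_j ≠ 0 for some j ∈ {1, …, m}, then the image of F contains (L_n)^{m+1}, the span of {e_{m+1}, …, e_n}. -/
/-- The span of the basis vectors `e_k, …, e_n` of `L_n`; this is `{0}` when `k > n`. -/
def nfPow (K : Type*) [Field K] (n k : ℕ) : Submodule K (Fin n → K) :=
  Submodule.span K {x | ∃ i : Fin n, k ≤ (i : ℕ) + 1 ∧ x = Pi.single i (1 : K)}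

/-- The multilinear map `F(v₁, …, v_m) = Σ_{σ ∈ S_m} α_σ · v_{σ(1)}v_{σ(2)}⋯v_{σ(m)}`
(left-normed products) on `L_n`, attached to a family of scalars `α_σ` indexed by
permutations of `{1, …, m}`. -/
noncomputable def multF (K : Type*) [Field K] (n m : ℕ)
    (α : Equiv.Perm (Fin m) → K) (v : Fin m → (Fin n → K)) : Fin n → K :=
  ∑ σ : Equiv.Perm (Fin m), α σ • lnProd K n (List.ofFn fun i => v (σ i))

theorem foldl_nfMul_apply (K : Type*) [Field K] (n : ℕ) (hn : 0 < n) (l : List (Fin n → K)) :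
    ∀ (a : Fin n → K) (k : Fin n), l.foldl (nfMul K n) a k =
      if (k : ℕ) < l.length then 0
      else (l.map (fun y => y ⟨0, hn⟩)).prod *
        a ⟨(k : ℕ) - l.length, Nat.lt_of_le_of_lt (Nat.sub_le _ _) k.isLt⟩ := by
  induction l with
  | nil => intro a k; simp
  | cons y t ih =>
    intro a k
    rw [List.foldl_cons, ih]
    by_cases h1 : (k : ℕ) < t.length
    · have h2 : (k : ℕ) < t.length + 1 := by omega
      simp [h1, h2]
    · by_cases h3 : (k : ℕ) < t.length + 1
      · have h4 : (k : ℕ) - t.length = 0 := by omega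
        simp [h1, h3, nfMul, h4]
      · have h4 : ¬ ((k : ℕ) - t.length = 0) := by omega
        have h5 : (k : ℕ) - (t.length + 1) = (k : ℕ) - t.length - 1 := by omega
        simp only [h1, if_false, nfMul, h4, List.length_cons, h3, List.map_cons,
          List.prod_cons, h5]
        ring

theorem nfPow_apply_eq_zero (K : Type*) [Field K] (n m : ℕ) (y : Fin n → K)
    (hy : y ∈ nfPow K n (m + 1)) (k : Fin n) (hk : (k : ℕ) < m) : y k = 0 := by
  unfold nfPow at hy
  induction hy using Submodule.span_induction with
  | mem x hx =>
    obtain ⟨i, hi, rfl⟩ := hx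
    have : k ≠ i := by rintro rfl; omega
    simp [this]
  | zero => rfl
  | add x y _ _ hx hy => simp [hx, hy]
  | smul a x _ hx => simp [hx]

/-- If `γ_j = Σ_{σ(1)=j} α_σ ≠ 0` for some `j ∈ {1, …, m}`, then the image of `F`
contains `(L_n)^{m+1}`, the span of `{e_{m+1}, …, e_n}`. -/
theorem Ln_multilinear_image_contains (K : Type*) [Field K] (n m : ℕ)
    (hn : 1 ≤ n) (hm : 1 ≤ m) (α : Equiv.Perm (Fin m) → K) (j : Fin m)
    (hj : ∑ σ ∈ Finset.univ.filter (fun σ : Equiv.Perm (Fin m) => σ ⟨0, hm⟩ = j),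
        α σ ≠ 0) :
    (nfPow K n (m + 1) : Set (Fin n → K)) ⊆ Set.range (multF K n m α) := by
  intro y hy
  obtain ⟨p, rfl⟩ : ∃ p, m = p + 1 := ⟨m - 1, by omega⟩
  have hy0 := nfPow_apply_eq_zero K n (p + 1) y hy
  have hzero : (⟨0, hm⟩ : Fin (p + 1)) = 0 := rfl
  rw [hzero] at hj
  set γ := ∑ σ ∈ Finset.univ.filter (fun σ : Equiv.Perm (Fin (p + 1)) => σ 0 = j), α σ with hγ
  let w : Fin n → K := fun k =>
    if (k : ℕ) = 0 then 0 else if h : (k : ℕ) + p < n then γ⁻¹ * y ⟨k + p, h⟩ else 0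
  let v : Fin (p + 1) → Fin n → K :=
    fun i => if i = j then w else Pi.single (⟨0, hn⟩ : Fin n) (1 : K)
  have hv0 : ∀ i, v i ⟨0, hn⟩ = if i = j then 0 else 1 := by
    intro i
    by_cases h : i = j <;> simp [v, w, h]
  have key : ∀ σ : Equiv.Perm (Fin (p + 1)),
      lnProd K n (List.ofFn fun i => v (σ i)) = if σ 0 = j then γ⁻¹ • y else 0 := by
    intro σ
    funext k
    rw [List.ofFn_succ]
    simp only [lnProd]
    rw [foldl_nfMul_apply K n hn, List.length_ofFn, List.map_ofFn, List.prod_ofFn]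
    simp only [Function.comp_apply, hv0]
    by_cases h : σ 0 = j
    · have h1 : ∀ i : Fin p, σ i.succ ≠ j := by
        intro i hi
        rw [← h] at hi
        exact Fin.succ_ne_zero i (σ.injective hi)
      simp only [h1, h, if_true, if_false, Finset.prod_const_one, one_mul, Pi.smul_apply,
        smul_eq_mul, v, w]
      by_cases hk : (k : ℕ) < p
      · simp [hk, hy0 k (by omega)]
      · by_cases hk2 : (k : ℕ) - p = 0
        · simp [hk2, hy0 k (by omega)]
        · have e : (k : ℕ) - p + p = k := by omega
          simp [hk, hk2, e]
    · obtain ⟨i, hi⟩ := σ.surjective j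
      have hi0 : i ≠ 0 := by rintro rfl; exact h hi
      obtain ⟨i', rfl⟩ := Fin.exists_succ_eq.mpr hi0
      rw [Finset.prod_eq_zero (Finset.mem_univ i') (by simp [hi])]
      simp [h]
  refine ⟨v, ?_⟩
  unfold multF
  simp only [key, smul_ite, smul_zero]
  rw [← Finset.sum_filter, ← Finset.sum_smul, ← hγ, smul_smul, mul_inv_cancel₀ hj, one_smul]
end

section
/- If γ ≠ 0, then the image of F equals (L_n)^m, the span of {e_m, …, e_n}. -/
theorem nf_foldl_apply (K : Type*) [Field K] (n : ℕ) (hn : 0 < n) (t : List (Fin n → K))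
    (a : Fin n → K) (k : Fin n) :
    t.foldl (nfMul K n) a k = if (k : ℕ) < t.length then 0
      else (t.map (fun y => y ⟨0, hn⟩)).prod *
        a ⟨(k : ℕ) - t.length, Nat.lt_of_le_of_lt (Nat.sub_le _ _) k.isLt⟩ := by
  induction t generalizing a with
  | nil => simp
  | cons y t ih =>
    rw [List.foldl_cons, ih]
    simp only [List.length_cons, List.map_cons, List.prod_cons, nfMul]
    by_cases h1 : (k : ℕ) < t.length
    · rw [if_pos h1, if_pos (by omega)]
    · rw [if_neg h1]
      by_cases h2 : (k : ℕ) < t.length + 1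
      · rw [if_pos h2, if_pos (by omega), mul_zero]
      · rw [if_neg h2, if_neg (by omega)]
        simp only [Nat.sub_sub]
        ring

theorem nf_mem_pow (K : Type*) [Field K] (n m : ℕ) (w : Fin n → K) :
    w ∈ nfPow K n m ↔ ∀ k : Fin n, (k : ℕ) + 1 < m → w k = 0 := by
  constructor
  · intro h
    unfold nfPow at h
    induction h using Submodule.span_induction with
    | mem x hx =>
      obtain ⟨i, hi, rfl⟩ := hx
      intro k hk
      apply Pi.single_eq_of_ne
      rintro rfl
      omega
    | zero => simp
    | add x y _ _ hx hy => intro k hk; simp [hx k hk, hy k hk]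
    | smul c x _ hx => intro k hk; simp [hx k hk]
  · intro h
    rw [← Finset.univ_sum_single w]
    refine Submodule.sum_mem _ fun i _ => ?_
    by_cases hi : m ≤ (i : ℕ) + 1
    · have : Pi.single i (w i) = w i • (Pi.single i (1 : K) : Fin n → K) := by
        rw [← Pi.single_smul]; simp
      rw [this]
      exact Submodule.smul_mem _ _ (Submodule.subset_span ⟨i, hi, rfl⟩)
    · rw [h i (by omega)]; simp

theorem nf_multF_apply (K : Type*) [Field K] (n p : ℕ) (hn : 0 < n)
    (α : Equiv.Perm (Fin (p + 1)) → K) (v : Fin (p + 1) → (Fin n → K)) (k : Fin n) :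
    multF K n (p + 1) α v k = ∑ σ, α σ * (if (k : ℕ) < p then 0
      else (∏ i : Fin p, v (σ i.succ) ⟨0, hn⟩) *
        v (σ 0) ⟨(k : ℕ) - p, Nat.lt_of_le_of_lt (Nat.sub_le _ _) k.isLt⟩) := by
  unfold multF
  rw [Finset.sum_apply]
  refine Finset.sum_congr rfl fun σ _ => ?_
  rw [Pi.smul_apply, smul_eq_mul, List.ofFn_succ, lnProd, nf_foldl_apply K n hn]
  simp only [List.length_ofFn, List.map_ofFn, List.prod_ofFn, Function.comp_def]

/-- If `γ = Σ_{σ ∈ S_m} α_σ ≠ 0`, then the image of `F` equals `(L_n)^m`, the span of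
`{e_m, …, e_n}`. -/
theorem Ln_multilinear_image_gamma_ne_zero (K : Type*) [Field K] (n m : ℕ)
    (hn : 1 ≤ n) (hm : 1 ≤ m) (α : Equiv.Perm (Fin m) → K)
    (hγ : ∑ σ : Equiv.Perm (Fin m), α σ ≠ 0) :
    Set.range (multF K n m α) = (nfPow K n m : Set (Fin n → K)) := by
  obtain ⟨p, rfl⟩ : ∃ p, m = p + 1 := ⟨m - 1, by omega⟩
  have hn' : 0 < n := hn
  ext w
  rw [SetLike.mem_coe, nf_mem_pow]
  constructor
  · rintro ⟨v, rfl⟩ k hk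
    rw [nf_multF_apply K n p hn']
    simp [show (k : ℕ) < p by omega]
  · intro hw
    obtain ⟨j, hj⟩ : ∃ j, ∑ σ : Equiv.Perm (Fin (p + 1)), (if σ 0 = j then α σ else 0) ≠ 0 := by
      by_contra! hcon
      apply hγ
      have : ∑ j, ∑ σ : Equiv.Perm (Fin (p + 1)), (if σ 0 = j then α σ else 0) = 0 :=
        Finset.sum_eq_zero fun j _ => hcon j
      rw [Finset.sum_comm] at this
      simpa using this
    set γ := ∑ σ, α σ with hγd
    set γj := ∑ σ : Equiv.Perm (Fin (p + 1)), (if σ 0 = j then α σ else 0) with hγj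
    let x : Fin n → K := fun i => if h : (i : ℕ) + p < n then
      w ⟨(i : ℕ) + p, h⟩ / (if (i : ℕ) = 0 then γ else γj) else 0
    let e : Fin n → K := fun i => if (i : ℕ) = 0 then 1 else 0
    refine ⟨fun i => if i = j then x else e, ?_⟩
    funext k
    rw [nf_multF_apply K n p hn']
    by_cases hk : (k : ℕ) < p
    · rw [hw k (by omega)]
      simp [hk]
    simp only [if_neg hk]
    have hprod : ∀ σ : Equiv.Perm (Fin (p + 1)),
        ∏ i : Fin p, (if σ i.succ = j then x else e) ⟨0, hn'⟩ =
          if σ 0 = j then 1 else x ⟨0, hn'⟩ := by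
      intro σ
      by_cases h : σ 0 = j
      · rw [if_pos h]
        refine Finset.prod_eq_one fun i _ => ?_
        rw [if_neg]
        · simp [e]
        · rw [← h]
          intro h'
          exact Fin.succ_ne_zero i (σ.injective h')
      · rw [if_neg h]
        have h1 : ∏ i : Fin (p + 1), (if σ i = j then x else e) ⟨0, hn'⟩ = x ⟨0, hn'⟩ := by
          rw [Equiv.prod_comp σ (fun i => (if i = j then x else e) ⟨0, hn'⟩),
            Finset.prod_eq_single j]
          · simp
          · intro b _ hb
            simp [hb, e]
          · simp
        rw [Fin.prod_univ_succ, if_neg h] at h1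
        simpa [e] using h1
    simp only [hprod]
    by_cases hkp : (k : ℕ) = p
    · have hx : x ⟨0, hn'⟩ = w k / γ := by
        have h0 : 0 + p < n := by have := k.isLt; omega
        have h1 : (⟨0 + p, h0⟩ : Fin n) = k := Fin.ext (by simp [hkp])
        simp only [x, dif_pos h0, h1, if_true]
      have : ∀ σ : Equiv.Perm (Fin (p + 1)), α σ * ((if σ 0 = j then 1 else x ⟨0, hn'⟩) *
          (if σ 0 = j then x else e) ⟨(k : ℕ) - p, Nat.lt_of_le_of_lt (Nat.sub_le _ _) k.isLt⟩)
          = α σ * (w k / γ) := by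
        intro σ
        have h2 : (⟨(k : ℕ) - p, Nat.lt_of_le_of_lt (Nat.sub_le _ _) k.isLt⟩ : Fin n)
          = ⟨0, hn'⟩ := Fin.ext (by simp [hkp])
        rw [h2]
        by_cases h : σ 0 = j
        · simp [h, hx]
        · simp [h, hx, e]
      rw [Finset.sum_congr rfl fun σ _ => this σ, ← Finset.sum_mul, ← hγd]
      field_simp
    · have hx : x ⟨(k : ℕ) - p, Nat.lt_of_le_of_lt (Nat.sub_le _ _) k.isLt⟩ = w k / γj := by
        have h0 : (k : ℕ) - p + p < n := by have := k.isLt; omega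
        have h1 : (⟨(k : ℕ) - p + p, h0⟩ : Fin n) = k := Fin.ext (by simp; omega)
        have h3 : ¬ ((k : ℕ) - p = 0) := by omega
        simp only [x, dif_pos h0, h1, if_neg h3]
      have he : e ⟨(k : ℕ) - p, Nat.lt_of_le_of_lt (Nat.sub_le _ _) k.isLt⟩ = 0 := by
        have h3 : ¬ ((k : ℕ) - p = 0) := by omega
        simp only [e, if_neg h3]
      have : ∀ σ : Equiv.Perm (Fin (p + 1)), α σ * ((if σ 0 = j then 1 else x ⟨0, hn'⟩) *
          (if σ 0 = j then x else e) ⟨(k : ℕ) - p, Nat.lt_of_le_of_lt (Nat.sub_le _ _) k.isLt⟩)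
          = (if σ 0 = j then α σ else 0) * (w k / γj) := by
        intro σ
        by_cases h : σ 0 = j
        · simp [h, hx]
        · simp [h, he]
      rw [Finset.sum_congr rfl fun σ _ => this σ, ← Finset.sum_mul, ← hγj]
      field_simp
end

section
/- If γ_j = 0 for every j ∈ {1, …, m}, then F(v_1, …, v_m) = 0 for all v_1, …, v_m ∈ L_n; that is, the corresponding multilinear polynomial is a polynomial identity of L_n. -/
theorem nfMul_right_comm (K : Type*) [Field K] (n : ℕ) (x y z : Fin n → K) :
    nfMul K n (nfMul K n x y) z = nfMul K n (nfMul K n x z) y := by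
  funext k
  simp only [nfMul]
  split_ifs
  · rfl
  · simp
  · ring

theorem lnProd_perm (K : Type*) [Field K] (n m : ℕ) (hm : 1 ≤ m)
    (v : Fin m → (Fin n → K)) (σ : Equiv.Perm (Fin m)) :
    lnProd K n (List.ofFn fun i => v (σ i)) =
      lnProd K n (v (σ ⟨0, hm⟩) :: ((List.finRange m).erase (σ ⟨0, hm⟩)).map v) := by
  obtain ⟨m, rfl⟩ : ∃ k, m = k + 1 := ⟨m - 1, by omega⟩
  have hp : (List.ofFn σ).Perm (List.finRange (m + 1)) := by
    rw [List.perm_ext_iff_of_nodup (List.nodup_ofFn.2 σ.injective) (List.nodup_finRange _)]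
    intro a
    simp only [List.mem_ofFn, List.mem_finRange, iff_true]
    exact σ.surjective a
  rw [List.ofFn_succ] at hp
  have ht := ((List.cons_perm_iff_perm_erase.1 hp).2).map v
  rw [List.map_ofFn] at ht
  rw [List.ofFn_succ]
  haveI : RightCommutative (nfMul K n) := ⟨nfMul_right_comm K n⟩
  exact ht.foldl_eq _

/-- If `γ_j = Σ_{σ(1)=j} α_σ = 0` for every `j ∈ {1, …, m}`, then
`F(v₁, …, v_m) = 0` for all `v₁, …, v_m ∈ L_n`; that is, the corresponding
multilinear polynomial is a polynomial identity of `L_n`. -/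
theorem Ln_multilinear_identity (K : Type*) [Field K] (n m : ℕ)
    (hn : 1 ≤ n) (hm : 1 ≤ m) (α : Equiv.Perm (Fin m) → K)
    (h : ∀ j : Fin m,
      ∑ σ ∈ Finset.univ.filter (fun σ : Equiv.Perm (Fin m) => σ ⟨0, hm⟩ = j),
        α σ = 0) :
    ∀ v : Fin m → (Fin n → K), multF K n m α v = 0 := by
  intro v
  unfold multF
  rw [← Finset.sum_fiberwise (s := Finset.univ)
    (g := fun σ : Equiv.Perm (Fin m) => σ ⟨0, hm⟩)]
  refine Finset.sum_eq_zero fun j _ => ?_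
  have key : ∀ σ ∈ Finset.univ.filter (fun σ : Equiv.Perm (Fin m) => σ ⟨0, hm⟩ = j),
      α σ • lnProd K n (List.ofFn fun i => v (σ i)) =
        α σ • lnProd K n (v j :: ((List.finRange m).erase j).map v) := by
    intro σ hσ
    rw [lnProd_perm K n m hm v σ, (Finset.mem_filter.1 hσ).2]
  rw [Finset.sum_congr rfl key, ← Finset.sum_smul, h j, zero_smul]
end

section
/- Suppose F is not identically zero on L_n and α_1 + ⋯ + α_m = 0. Then the image of F equals (L_n)^{d+1}, the span of {e_{d+1}, …, e_n}. In particular, the image of F is a K-vector subspace of L_n. -/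
/-- `rpow K n a b s` is the left-normed product `a·b^{(s)} = ((⋯((a·b)·b)⋯)·b)` with
`s` factors `b`. -/
def rpow (K : Type*) [Field K] (n : ℕ) (a b : Fin n → K) (s : ℕ) : Fin n → K :=
  (fun t => nfMul K n t b)^[s] a

/-- The basis vector `e_d` of `L_n` (`1`-indexed), interpreted as `0` when `d > n`
or `d = 0`. -/
def eVec (K : Type*) [Field K] (n d : ℕ) : Fin n → K :=
  fun k => if (k : ℕ) + 1 = d then 1 else 0

/-- The map
`F(v₁, …, v_m) = Σ_{j=1}^m α_j · v_j v₁^{(d₁)} ⋯ v_{j−1}^{(d_{j−1})} v_j^{(d_j−1)} v_{j+1}^{(d_{j+1})} ⋯ v_m^{(d_m)}`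
(left-normed products) on `L_n`: the general multihomogeneous polynomial of
multidegree `(d₁, …, d_m)` reduced modulo the polynomial identities of `L_n`. -/
noncomputable def homF (K : Type*) [Field K] (n m : ℕ) (d : Fin m → ℕ)
    (α : Fin m → K) (v : Fin m → (Fin n → K)) : Fin n → K :=
  ∑ j : Fin m, α j •
    (List.finRange m).foldl
      (fun acc l => rpow K n acc (v l) (if l = j then d l - 1 else d l)) (v j)

theorem rpow_apply_aux (K : Type*) [Field K] (n : ℕ) (hn : 0 < n) (b : Fin n → K) (s : ℕ) :
    ∀ (a : Fin n → K) (k : Fin n), rpow K n a b s k =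
      if (k : ℕ) < s then 0 else
        b ⟨0, hn⟩ ^ s * a ⟨(k : ℕ) - s, Nat.lt_of_le_of_lt (Nat.sub_le _ _) k.isLt⟩ := by
  induction s with
  | zero => intro a k; simp [rpow]
  | succ s ih =>
    intro a k
    have h : rpow K n a b (s + 1) = rpow K n (nfMul K n a b) b s := by
      simp [rpow, Function.iterate_succ_apply]
    rw [h, ih]
    unfold nfMul
    by_cases h1 : (k : ℕ) < s
    · rw [if_pos h1, if_pos (by omega)]
    · rw [if_neg h1]
      by_cases h2 : (k : ℕ) < s + 1
      · rw [if_pos h2, if_pos (show (k : ℕ) - s = 0 by omega), mul_zero]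
      · rw [if_neg h2, if_neg (show ¬ (k : ℕ) - s = 0 by omega), pow_succ, mul_assoc]
        rfl

theorem foldl_apply_aux (K : Type*) [Field K] (n m : ℕ) (hn : 0 < n) (v : Fin m → (Fin n → K))
    (s : Fin m → ℕ) (L : List (Fin m)) :
    ∀ (a : Fin n → K) (k : Fin n),
      L.foldl (fun acc l => rpow K n acc (v l) (s l)) a k =
      if (k : ℕ) < (L.map s).sum then 0 else
        (L.map (fun l => v l ⟨0, hn⟩ ^ s l)).prod *
          a ⟨(k : ℕ) - (L.map s).sum, Nat.lt_of_le_of_lt (Nat.sub_le _ _) k.isLt⟩ := by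
  induction L with
  | nil => intro a k; simp
  | cons l L ih =>
    intro a k
    rw [List.foldl_cons, ih, rpow_apply_aux K n hn]
    simp only [List.map_cons, List.sum_cons, List.prod_cons]
    by_cases h1 : (k : ℕ) < (L.map s).sum
    · rw [if_pos h1, if_pos (by omega)]
    · rw [if_neg h1]
      by_cases h2 : (k : ℕ) < s l + (L.map s).sum
      · rw [if_pos h2, if_pos (by omega), mul_zero]
      · rw [if_neg h2, if_neg (by omega)]
        have : (k : ℕ) - (L.map s).sum - s l = (k : ℕ) - (s l + (L.map s).sum) := by omega
        simp only [this]
        ring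

theorem homF_apply_aux (K : Type*) [Field K] (n m : ℕ) (hn : 0 < n) (d : Fin m → ℕ)
    (hd : ∀ j, 1 ≤ d j) (α : Fin m → K) (v : Fin m → (Fin n → K)) (k : Fin n) :
    homF K n m d α v k = ∑ j : Fin m, α j *
      (if (k : ℕ) < (∑ l, d l) - 1 then 0 else
        (∏ l, v l ⟨0, hn⟩ ^ (if l = j then d l - 1 else d l)) *
          v j ⟨(k : ℕ) - ((∑ l, d l) - 1), Nat.lt_of_le_of_lt (Nat.sub_le _ _) k.isLt⟩) := by
  unfold homF
  rw [Finset.sum_apply]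
  refine Finset.sum_congr rfl fun j _ => ?_
  rw [Pi.smul_apply, smul_eq_mul,
    foldl_apply_aux K n m hn v (fun l => if l = j then d l - 1 else d l)]
  have hs : ((List.finRange m).map (fun l => if l = j then d l - 1 else d l)).sum
      = (∑ l, d l) - 1 := by
    rw [← Fin.sum_univ_def]
    have : ∑ l, d l = ∑ l, ((if l = j then d l - 1 else d l) + (if l = j then 1 else 0)) := by
      refine Finset.sum_congr rfl fun l _ => ?_
      have := hd l
      split_ifs <;> omega
    rw [this, Finset.sum_add_distrib]
    simp
  simp only [hs, Fin.prod_univ_def]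

theorem mem_nfPow_aux (K : Type*) [Field K] (n k : ℕ) (w : Fin n → K) :
    w ∈ nfPow K n k ↔ ∀ i : Fin n, (i : ℕ) + 1 < k → w i = 0 := by
  constructor
  · intro hw
    unfold nfPow at hw
    induction hw using Submodule.span_induction with
    | mem x hx =>
      obtain ⟨i, hi, rfl⟩ := hx
      intro l hl
      rw [Pi.single_apply, if_neg]
      rintro rfl
      omega
    | zero => intro i _; rfl
    | add x y _ _ hx hy => intro i hi; simp [hx i hi, hy i hi]
    | smul a x _ hx => intro i hi; simp [hx i hi]
  · intro h
    rw [pi_eq_sum_univ' w]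
    refine Submodule.sum_mem _ fun i _ => ?_
    by_cases hi : (i : ℕ) + 1 < k
    · rw [h i hi, zero_smul]; exact Submodule.zero_mem _
    · refine Submodule.smul_mem _ _ (Submodule.subset_span ⟨i, by omega, ?_⟩)
      ext l
      simp [Pi.single_apply, eq_comm]

/-- Suppose the multihomogeneous map `F` (of multidegree `(d₁, …, d_m)`, each
`d_j ≥ 1`, with `d = d₁ + ⋯ + d_m`) is not identically zero on `L_n` and
`α₁ + ⋯ + α_m = 0`.  Then the image of `F` equals `(L_n)^{d+1}`, the span of
`{e_{d+1}, …, e_n}`; in particular it is a `K`-vector subspace of `L_n`. -/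
theorem Ln_homogeneous_image_sum_zero (K : Type*) [Field K] (n m : ℕ)
    (hn : 1 ≤ n) (hm : 1 ≤ m) (d : Fin m → ℕ) (hd : ∀ j, 1 ≤ d j) (α : Fin m → K)
    (hne : ∃ v : Fin m → (Fin n → K), homF K n m d α v ≠ 0)
    (hα : ∑ j : Fin m, α j = 0) :
    Set.range (homF K n m d α) = (nfPow K n ((∑ j : Fin m, d j) + 1) : Set (Fin n → K)) := by
  have hn0 : 0 < n := hn
  have hD : 1 ≤ ∑ l, d l := le_trans (hd ⟨0, hm⟩)
    (Finset.single_le_sum (f := d) (fun _ _ => Nat.zero_le _) (Finset.mem_univ _))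
  obtain ⟨j, hj⟩ : ∃ j, α j ≠ 0 := by
    by_contra! h
    obtain ⟨v, hv⟩ := hne
    exact hv (by simp [homF, h])
  ext w
  rw [SetLike.mem_coe, mem_nfPow_aux]
  constructor
  · rintro ⟨v, rfl⟩ i hi
    rw [homF_apply_aux K n m hn0 d hd]
    by_cases h1 : (i : ℕ) < (∑ l, d l) - 1
    · simp [h1]
    · simp only [if_neg h1]
      have h0 : (i : ℕ) - ((∑ l, d l) - 1) = 0 := by omega
      simp only [h0]
      have hp : ∀ t : Fin m, (∏ l, v l ⟨0, hn0⟩ ^ (if l = t then d l - 1 else d l)) *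
          v t ⟨0, hn0⟩ = ∏ l, v l ⟨0, hn0⟩ ^ d l := by
        intro t
        have h2 : v t ⟨0, hn0⟩ = ∏ l, (if l = t then v l ⟨0, hn0⟩ else 1) := by simp
        conv_lhs => rw [h2]
        rw [← Finset.prod_mul_distrib]
        refine Finset.prod_congr rfl fun l _ => ?_
        split_ifs
        · rw [← pow_succ, Nat.sub_add_cancel (hd l)]
        · rw [mul_one]
      simp only [hp]
      rw [← Finset.sum_mul, hα, zero_mul]
  · intro hw
    refine ⟨fun l i => if (i : ℕ) = 0 then 1 else if l = j then
      (if h : (i : ℕ) + ((∑ l, d l) - 1) < n then (α j)⁻¹ * w ⟨_, h⟩ else 0) else 0, ?_⟩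
    ext k
    rw [homF_apply_aux K n m hn0 d hd]
    by_cases h1 : (k : ℕ) < (∑ l, d l) - 1
    · rw [hw k (by omega)]
      simp [h1]
    · simp only [if_neg h1, if_true, one_pow, Finset.prod_const_one, one_mul]
      by_cases h2 : (k : ℕ) - ((∑ l, d l) - 1) = 0
      · simp only [if_pos h2, mul_one]
        rw [hα, hw k (by omega)]
      · have h3 : (k : ℕ) - ((∑ l, d l) - 1) + ((∑ l, d l) - 1) = k := by omega
        simp only [if_neg h2, h3, dif_pos k.isLt]
        simp [hj]
end
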